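/- Let H ∈ [1/2, 1). With κ_H = 2H·Γ(3/2−H)·Γ(1/2+H), λ_H = H·Γ(3−2H)·Γ(H+1/2)/(2(1−H)·Γ(3/2−H)), k_H(t,s) = κ_H⁻¹ s^{1/2−H}(t−s)^{1/2−H} and w_H(t) = t^{2−2H}/(2λ_H(2−2H)), the input u(t) = (κ_H/√(2λ_H))·t^{H−1/2} is transformed into v(t) = √(2λ_H)·t^{H−1/2}; that is, for every t > 0, (d/dw_H(t)) ∫₀ᵗ k_H(t,s)·(κ_H/√(2λ_H))·s^{H−1/2} ds = √(2λ_H)·t^{H−1/2}. Moreover, for every T > 0, (1/T)·∫₀ᵀ |√(2λ_H)·t^{H−1/2}|² dw_H(t) = 1, so this v belongs to the control class 𝒱_T = { v : (1/T)∫₀ᵀ |v(t)|² dw_H(t) ≤ 1 }. -/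

import Mathlib

/-- `κ_H = 2H Γ(3/2 - H) Γ(1/2 + H)`. -/
noncomputable def kappaH (H : ℝ) : ℝ :=
  2 * H * Real.Gamma (3 / 2 - H) * Real.Gamma (1 / 2 + H)

/-- `λ_H = H Γ(3 - 2H) Γ(H + 1/2) / (2(1 - H) Γ(3/2 - H))`. -/
noncomputable def lambdaH (H : ℝ) : ℝ :=
  H * Real.Gamma (3 - 2 * H) * Real.Gamma (H + 1 / 2) / (2 * (1 - H) * Real.Gamma (3 / 2 - H))

/-- The kernel `k_H(t,s) = κ_H⁻¹ s^{1/2-H} (t-s)^{1/2-H}`. -/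
noncomputable def kerH (H t s : ℝ) : ℝ :=
  (kappaH H)⁻¹ * s ^ ((1 : ℝ) / 2 - H) * (t - s) ^ ((1 : ℝ) / 2 - H)

/-- `w_H(t) = t^{2-2H} / (2 λ_H (2 - 2H))`. -/
noncomputable def wH (H t : ℝ) : ℝ :=
  t ^ (2 - 2 * H) / (2 * lambdaH H * (2 - 2 * H))

theorem kappaH_pos {H : ℝ} (hH : H ∈ Set.Ico (1 / 2 : ℝ) 1) : 0 < kappaH H := by
  obtain ⟨h1, h2⟩ := hH
  have hΓ₁ := Real.Gamma_pos_of_pos (show 0 < 3 / 2 - H by linarith)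
  have hΓ₂ := Real.Gamma_pos_of_pos (show 0 < 1 / 2 + H by linarith)
  have : 0 < H := by linarith
  unfold kappaH
  positivity

theorem lambdaH_pos {H : ℝ} (hH : H ∈ Set.Ico (1 / 2 : ℝ) 1) : 0 < lambdaH H := by
  obtain ⟨h1, h2⟩ := hH
  have hΓ₁ := Real.Gamma_pos_of_pos (show 0 < 3 / 2 - H by linarith)
  have hΓ₂ := Real.Gamma_pos_of_pos (show 0 < H + 1 / 2 by linarith)
  have hΓ₃ := Real.Gamma_pos_of_pos (show 0 < 3 - 2 * H by linarith)
  have : 0 < H := by linarith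
  have : 0 < 1 - H := by linarith
  unfold lambdaH
  positivity

/-- The density of `dw_H` with respect to Lebesgue measure. -/
theorem deriv_wH {H t : ℝ} (hH : H ∈ Set.Ico (1 / 2 : ℝ) 1) (ht : 0 < t) :
    deriv (wH H) t = t ^ (1 - 2 * H) / (2 * lambdaH H) := by
  have hl := (lambdaH_pos hH).ne'
  have h2 : 2 - 2 * H ≠ 0 := by linarith [hH.2]
  have h : HasDerivAt (wH H)
      ((2 - 2 * H) * t ^ (2 - 2 * H - 1) / (2 * lambdaH H * (2 - 2 * H))) t :=
    (Real.hasDerivAt_rpow_const (Or.inl ht.ne')).div_const _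
  rw [h.deriv, show 2 - 2 * H - 1 = 1 - 2 * H by ring, mul_comm (2 * lambdaH H),
    mul_div_mul_left _ _ h2]

/-- The power singularities of the kernel and of the optimal input cancel at the origin. -/
theorem integral_kerH_mul_input {H τ : ℝ} (hH : H ∈ Set.Ico (1 / 2 : ℝ) 1) (hτ : 0 < τ) :
    ∫ s in (0 : ℝ)..τ, kerH H τ s * (kappaH H / Real.sqrt (2 * lambdaH H)) * s ^ (H - 1 / 2) =
      τ ^ (3 / 2 - H) / (3 / 2 - H) / Real.sqrt (2 * lambdaH H) := by
  have hk := (kappaH_pos hH).ne'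
  have hcancel : ∀ s ∈ Set.uIoc 0 τ,
      kerH H τ s * (kappaH H / Real.sqrt (2 * lambdaH H)) * s ^ (H - 1 / 2) =
        (τ - s) ^ ((1 : ℝ) / 2 - H) / Real.sqrt (2 * lambdaH H) := by
    intro s hs
    rw [Set.uIoc_of_le hτ.le] at hs
    have hs1 : s ^ ((1 : ℝ) / 2 - H) * s ^ (H - 1 / 2) = 1 := by
      rw [← Real.rpow_add hs.1, show (1 : ℝ) / 2 - H + (H - 1 / 2) = 0 by ring, Real.rpow_zero]
    calc _ = (kappaH H)⁻¹ * kappaH H * (s ^ ((1 : ℝ) / 2 - H) * s ^ (H - 1 / 2)) *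
          ((τ - s) ^ ((1 : ℝ) / 2 - H) / Real.sqrt (2 * lambdaH H)) := by
          unfold kerH; ring
      _ = _ := by rw [hs1, inv_mul_cancel₀ hk]; ring
  rw [intervalIntegral.integral_congr_ae (Filter.Eventually.of_forall hcancel),
    intervalIntegral.integral_div,
    intervalIntegral.integral_comp_sub_left (fun x : ℝ => x ^ ((1 : ℝ) / 2 - H)) τ,
    sub_self, sub_zero, integral_rpow (Or.inl (by linarith [hH.2])),
    show (1 : ℝ) / 2 - H + 1 = 3 / 2 - H by ring,
    Real.zero_rpow (by linarith [hH.2]), sub_zero]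

/-- The input `u(t) = (κ_H/√(2λ_H)) t^{H-1/2}` is transformed into
`v(t) = √(2λ_H) t^{H-1/2}`, i.e. `(d/dw_H(t)) ∫₀ᵗ k_H(t,s) u(s) ds = √(2λ_H) t^{H-1/2}`,
and this `v` satisfies the energy constraint `(1/T) ∫₀ᵀ |v(t)|² dw_H(t) = 1`, so it
belongs to the control class `𝒱_T`. -/
theorem optimal_input_transform_and_energy
    (H : ℝ) (hH : H ∈ Set.Ico (1 / 2 : ℝ) 1) :
    (∀ t : ℝ, 0 < t →
      HasDerivAt (fun τ : ℝ => ∫ s in (0 : ℝ)..τ,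
          kerH H τ s * (kappaH H / Real.sqrt (2 * lambdaH H)) * s ^ (H - 1 / 2))
        (deriv (wH H) t * (Real.sqrt (2 * lambdaH H) * t ^ (H - 1 / 2))) t) ∧
    ∀ T : ℝ, 0 < T →
      (1 / T) * ∫ t in (0 : ℝ)..T,
          |Real.sqrt (2 * lambdaH H) * t ^ (H - 1 / 2)| ^ 2 * deriv (wH H) t = 1 := by
  have hl := lambdaH_pos hH
  refine ⟨fun t ht => ?_, fun T hT => ?_⟩
  · have h3 : 3 / 2 - H ≠ 0 := by linarith [hH.2]
    have hd : HasDerivAt (fun τ : ℝ => τ ^ (3 / 2 - H) / (3 / 2 - H) / Real.sqrt (2 * lambdaH H))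
        ((3 / 2 - H) * t ^ (3 / 2 - H - 1) / (3 / 2 - H) / Real.sqrt (2 * lambdaH H)) t :=
      ((Real.hasDerivAt_rpow_const (Or.inl ht.ne')).div_const _).div_const _
    have hval : deriv (wH H) t * (Real.sqrt (2 * lambdaH H) * t ^ (H - 1 / 2)) =
        (3 / 2 - H) * t ^ (3 / 2 - H - 1) / (3 / 2 - H) / Real.sqrt (2 * lambdaH H) := by
      rw [deriv_wH hH ht, mul_div_cancel_left₀ _ h3,
        show 3 / 2 - H - 1 = (1 - 2 * H) + (H - 1 / 2) by ring, Real.rpow_add ht]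
      have hs : Real.sqrt (2 * lambdaH H) ≠ 0 := by positivity
      have hsq : Real.sqrt (2 * lambdaH H) ^ 2 = 2 * lambdaH H := Real.sq_sqrt (by positivity)
      nth_rewrite 1 [← hsq]
      field_simp
    rw [hval]
    refine hd.congr_of_eventuallyEq ?_
    filter_upwards [eventually_gt_nhds ht] with τ hτ
    exact integral_kerH_mul_input hH hτ
  · have hone : ∀ t ∈ Set.uIoc 0 T,
        |Real.sqrt (2 * lambdaH H) * t ^ (H - 1 / 2)| ^ 2 * deriv (wH H) t = 1 := by
      intro t ht
      rw [Set.uIoc_of_le hT.le] at ht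
      have hpow : (t ^ (H - 1 / 2)) ^ 2 * t ^ (1 - 2 * H) = 1 := by
        rw [← Real.rpow_mul_natCast ht.1.le, ← Real.rpow_add ht.1,
          show (H - 1 / 2) * ((2 : ℕ) : ℝ) + (1 - 2 * H) = 0 by push_cast; ring, Real.rpow_zero]
      rw [deriv_wH hH ht.1, sq_abs, mul_pow, Real.sq_sqrt (by positivity), mul_assoc,
        ← mul_div_assoc, hpow]
      field_simp
    rw [intervalIntegral.integral_congr_ae (Filter.Eventually.of_forall hone),
      intervalIntegral.integral_const, sub_zero, smul_eq_mul, mul_one, one_div_mul_cancel hT.ne']
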